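/- arXiv:1401.3522 — 2 statements merged into one kernel-verified Lean document; each statement's English description precedes it below -/
import Mathlib

section
/- Every path cycle A ⊆ S is a graph cycle, i.e. A ∈ C = ∪_{k≥0} E^k. -/
open scoped ENNReal

namespace MetropolisCycles

variable {S : Type*} [Fintype S] [DecidableEq S]

/-- A path: a finite sequence of states whose consecutive members communicate. -/
def IsPath (q : S → S → ℝ) (ω : List S) : Prop :=
  ω.Chain' (fun a b => 0 < q a b)

/-- `x` and `y` are joined by a path entirely contained in `G`. -/
def JoinedIn (q : S → S → ℝ) (G : Set S) (x y : S) : Prop :=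
  ∃ ω : List S, ω.head? = some x ∧ ω.getLast? = some y ∧ IsPath q ω ∧ ∀ z ∈ ω, z ∈ G

/-- `G` is connected: any two of its points are joined by a path inside `G`. -/
def IsConnectedSet (q : S → S → ℝ) (G : Set S) : Prop :=
  ∀ x ∈ G, ∀ y ∈ G, JoinedIn q G x y

/-- The exterior boundary `∂G`. -/
def extBoundary (q : S → S → ℝ) (G : Set S) : Set S :=
  {y | y ∉ G ∧ ∃ x ∈ G, 0 < q x y}

/-- `A` is a non-trivial path cycle: connected and `max_A H < min_{∂A} H`. -/
def IsNontrivialPathCycle (H : S → ℝ) (q : S → S → ℝ) (A : Set S) : Prop :=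
  A.Nonempty ∧ IsConnectedSet q A ∧ ∀ x ∈ A, ∀ y ∈ extBoundary q A, H x < H y

/-- `A` is a path cycle: a singleton or a non-trivial path cycle. -/
def IsPathCycle (H : S → ℝ) (q : S → S → ℝ) (A : Set S) : Prop :=
  (∃ x, A = {x}) ∨ IsNontrivialPathCycle H q A

/-- The set of points joined to `x` by a path whose points all have energy at most `c`. -/
def energyCut (H : S → ℝ) (q : S → S → ℝ) (c : ℝ) (x : S) : Set S :=
  {y | JoinedIn q {z | H z ≤ c} x y}

/-- `U_{≤ x}`: the points joined to `x` by a path with energies at most `H x`. -/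
def Ule (H : S → ℝ) (q : S → S → ℝ) (x : S) : Set S := energyCut H q (H x) x

/-- The total cost of a path of cycles with respect to a cost function `Vs`. -/
noncomputable def listCost (Vs : Set S → Set S → ℝ≥0∞) : List (Set S) → ℝ≥0∞
  | [] => 0
  | [_] => 0
  | B :: B' :: l => Vs B B' + listCost Vs (B' :: l)

/-- `H_e` relative to a level `(E, V)` of the construction:
`H_e(A) = min { V(A,A') : A' ∈ E, A' ≠ A }`. -/
noncomputable def HeAux (E : Set (Set S)) (V : Set S → Set S → ℝ≥0∞) (A : Set S) : ℝ≥0∞ :=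
  ⨅ A' ∈ E \ {A}, V A A'

/-- The renormalized cost function `V_* (A,B) = V(A,B) - H_e(A)`. -/
noncomputable def VsAux (E : Set (Set S)) (V : Set S → Set S → ℝ≥0∞) (A B : Set S) : ℝ≥0∞ :=
  V A B - HeAux E V A

/-- `A →_k A'`: some path of elements of `E` from `A` to `A'` has zero total `V_*`-cost. -/
def arrowAux (E : Set (Set S)) (V : Set S → Set S → ℝ≥0∞) (A A' : Set S) : Prop :=
  ∃ l : List (Set S), l.head? = some A ∧ l.getLast? = some A' ∧ (∀ B ∈ l, B ∈ E) ∧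
    listCost (VsAux E V) l = 0

/-- The set `D^{k+1}`: unions of the `R_k`-equivalence classes. -/
def DAux (E : Set (Set S)) (V : Set S → Set S → ℝ≥0∞) : Set (Set S) :=
  {B | ∃ A ∈ E, B = ⋃₀ {A' | A' ∈ E ∧ arrowAux E V A A' ∧ arrowAux E V A' A}}

/-- The order relation `≥^{k+1}` on `D^{k+1}`. -/
def geqAux (E : Set (Set S)) (V : Set S → Set S → ℝ≥0∞) (B B' : Set S) : Prop :=
  ∃ C ∈ E, ∃ C' ∈ E, C ⊆ B ∧ C' ⊆ B' ∧ arrowAux E V C C'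

/-- `D_*^{k+1}`: the minimal elements of `D^{k+1}` for `≥^{k+1}`. -/
def DstarAux (E : Set (Set S)) (V : Set S → Set S → ℝ≥0∞) : Set (Set S) :=
  {B ∈ DAux E V | ∀ B' ∈ DAux E V, geqAux E V B B' → B' = B}

/-- `E^{k+1}` built from `(E^k, V^k)`. -/
def EnextAux (E : Set (Set S)) (V : Set S → Set S → ℝ≥0∞) : Set (Set S) :=
  DstarAux E V ∪ {A | A ∈ E ∧ ∃ B ∈ DAux E V \ DstarAux E V, A ⊆ B}

/-- `H_m^{k+1}(A) = max { H_e^k(A') : A' ∈ E^k, A' ⊆ A }`. -/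
noncomputable def HmAux (E : Set (Set S)) (V : Set S → Set S → ℝ≥0∞) (A : Set S) : ℝ≥0∞ :=
  ⨆ A' ∈ {A' | A' ∈ E ∧ A' ⊆ A}, HeAux E V A'

/-- `V^{k+1}(A,A') = H_m^{k+1}(A) + min { V_*^k(B,B') : B,B' ∈ E^k, B ⊆ A, B' ⊆ A' }`. -/
noncomputable def VnextAux (E : Set (Set S)) (V : Set S → Set S → ℝ≥0∞) (A A' : Set S) : ℝ≥0∞ :=
  HmAux E V A + ⨅ B ∈ {B | B ∈ E ∧ B ⊆ A}, ⨅ B' ∈ {B' | B' ∈ E ∧ B' ⊆ A'}, VsAux E V B B'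

/-- The zero-order cost function `V^0({i},{j}) = (H j - H i)⁺` if `q i j > 0`, `∞` otherwise
(and `∞` on non-singletons). -/
noncomputable def V0 (H : S → ℝ) (q : S → S → ℝ) (A B : Set S) : ℝ≥0∞ :=
  ⨅ i ∈ A, ⨅ j ∈ B, ⨅ _ : A = {i} ∧ B = {j} ∧ 0 < q i j, ENNReal.ofReal (H j - H i)

/-- The recursive construction `k ↦ (E^k, V^k)`. -/
noncomputable def cycEV (H : S → ℝ) (q : S → S → ℝ) : ℕ → Set (Set S) × (Set S → Set S → ℝ≥0∞)
  | 0 => ({A | ∃ i, A = {i}}, V0 H q)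
  | k + 1 => (EnextAux (cycEV H q k).1 (cycEV H q k).2,
              VnextAux (cycEV H q k).1 (cycEV H q k).2)

/-- The `k`-th order set of graph cycles `E^k`. -/
noncomputable def Ecyc (H : S → ℝ) (q : S → S → ℝ) (k : ℕ) : Set (Set S) := (cycEV H q k).1

/-- The `k`-th order cost function `V^k`. -/
noncomputable def Vcyc (H : S → ℝ) (q : S → S → ℝ) (k : ℕ) : Set S → Set S → ℝ≥0∞ :=
  (cycEV H q k).2

/-- `H_e^k(A)`. -/
noncomputable def Hek (H : S → ℝ) (q : S → S → ℝ) (k : ℕ) (A : Set S) : ℝ≥0∞ :=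
  HeAux (Ecyc H q k) (Vcyc H q k) A

/-- `H_m^k(A)` (defined for `k ≥ 1`; set to `0` at `k = 0`). -/
noncomputable def Hmk (H : S → ℝ) (q : S → S → ℝ) : ℕ → Set S → ℝ≥0∞
  | 0 => fun _ => 0
  | k + 1 => fun A => HmAux (Ecyc H q k) (Vcyc H q k) A

/-- `D^{n+1}` (indexed by `n`). -/
noncomputable def Dcyc (H : S → ℝ) (q : S → S → ℝ) (n : ℕ) : Set (Set S) :=
  DAux (Ecyc H q n) (Vcyc H q n)

/-- `D_*^{n+1}` (indexed by `n`). -/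
noncomputable def DstarCyc (H : S → ℝ) (q : S → S → ℝ) (n : ℕ) : Set (Set S) :=
  DstarAux (Ecyc H q n) (Vcyc H q n)

/-- The set of graph cycles `C = ∪_k E^k`. -/
def GraphCycles (H : S → ℝ) (q : S → S → ℝ) : Set (Set S) := {A | ∃ k, A ∈ Ecyc H q k}

/-- `H_e(A) = sup { H_e^k(A) : k ≥ 0, A ∈ E^k }` (for a graph cycle `A ≠ S`). -/
noncomputable def HeC (H : S → ℝ) (q : S → S → ℝ) (A : Set S) : ℝ≥0∞ :=
  ⨆ k, ⨆ _ : A ∈ Ecyc H q k, Hek H q k A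

/-- `H_m(A) = max( sup { H_e(B) : B ∈ C, B ⊆ A, B ≠ A }, 0 )` (for `|A| > 1`). -/
noncomputable def HmC (H : S → ℝ) (q : S → S → ℝ) (A : Set S) : ℝ≥0∞ :=
  ⨆ B ∈ {B | B ∈ GraphCycles H q ∧ B ⊆ A ∧ B ≠ A}, HeC H q B

open scoped NNReal

set_option linter.unusedSectionVars false

theorem _root_.ENNReal.iInf_tsub {ι : Type*} (f : ι → ℝ≥0∞) {a : ℝ≥0∞} (ha : a ≠ ⊤) :
    (⨅ i, f i) - a = ⨅ i, (f i - a) :=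
  Monotone.map_iInf_of_continuousAt (f := fun x => x - a)
    (ENNReal.continuous_sub_right a).continuousAt (fun _ _ h => tsub_le_tsub_right h a)
    (ENNReal.top_sub ha)

/-- The least energy in `A`. -/
noncomputable def bottom (h : S → ℝ≥0) (A : Set S) : ℝ≥0∞ := ⨅ x ∈ A, (h x : ℝ≥0∞)

/-- The least energy of an edge from `A` to `B`, the energy of an edge being the larger of the
energies of its endpoints. -/
noncomputable def edgeHeight (h : S → ℝ≥0) (q : S → S → ℝ) (A B : Set S) : ℝ≥0∞ :=
  ⨅ p : S × S, ⨅ _ : p.1 ∈ A ∧ p.2 ∈ B ∧ 0 < q p.1 p.2, (max (h p.1) (h p.2) : ℝ≥0)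

/-- The least energy of an edge leaving `A`. -/
noncomputable def exitHeight (h : S → ℝ≥0) (q : S → S → ℝ) (A : Set S) : ℝ≥0∞ :=
  edgeHeight h q A Aᶜ

/-- `E` is a partition of `S` and `V` is the cost function induced on it by the energy. -/
structure IsLevel (h : S → ℝ≥0) (q : S → S → ℝ) (E : Set (Set S))
    (V : Set S → Set S → ℝ≥0∞) : Prop where
  isPartition : Setoid.IsPartition E
  cost : ∀ A ∈ E, ∀ B ∈ E, A ≠ B → V A B = edgeHeight h q A B - bottom h A

/-- `B` is a cheapest member of `E` to jump to from `A`. -/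
def Step (h : S → ℝ≥0) (q : S → S → ℝ) (E : Set (Set S)) (A B : Set S) : Prop :=
  A ∈ E ∧ B ∈ E ∧ A ≠ B ∧ edgeHeight h q A B ≤ exitHeight h q A

/-- The union of the equivalence class of `A`. -/
def mergedClass (E : Set (Set S)) (V : Set S → Set S → ℝ≥0∞) (A : Set S) : Set S :=
  ⋃₀ {A' | A' ∈ E ∧ arrowAux E V A A' ∧ arrowAux E V A' A}

/-- Every member of `E` is either contained in `G` or disjoint from it. -/
def Compatible (E : Set (Set S)) (G : Set S) : Prop :=
  ∀ A ∈ E, (A ∩ G).Nonempty → A ⊆ G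

theorem JoinedIn.exists_crossing {q : S → S → ℝ} {G A : Set S} {x y : S}
    (h : JoinedIn q G x y) (hx : x ∈ A) (hy : y ∉ A) :
    ∃ a ∈ A, ∃ b ∉ A, a ∈ G ∧ b ∈ G ∧ 0 < q a b := by
  obtain ⟨ω, h1, h2, h3, h4⟩ := h
  induction ω generalizing x with
  | nil => simp at h1
  | cons a l ih =>
    obtain rfl : a = x := by simpa using h1
    cases l with
    | nil =>
      obtain rfl : a = y := by simpa using h2
      exact absurd hx hy
    | cons b l =>
      have hab : 0 < q a b ∧ IsPath q (b :: l) :=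
        List.isChain_cons_cons.1 h3
      by_cases hb : b ∈ A
      · exact ih hb (by simp) (by simpa using h2) hab.2 fun z hz => h4 z (by simp [hz])
      · exact ⟨a, hx, b, hb, h4 a (by simp), h4 b (by simp), hab.1⟩

section Heights

variable {h : S → ℝ≥0} {q : S → S → ℝ} {A B : Set S}

theorem bottom_ne_top (hA : A.Nonempty) : bottom h A ≠ ⊤ := by
  obtain ⟨x, hx⟩ := hA
  exact ne_top_of_le_ne_top ENNReal.coe_ne_top (iInf₂_le x hx)

theorem edgeHeight_le {x y : S} (hx : x ∈ A) (hy : y ∈ B) (hxy : 0 < q x y) :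
    edgeHeight h q A B ≤ (max (h x) (h y) : ℝ≥0) :=
  iInf₂_le (x, y) ⟨hx, hy, hxy⟩

theorem le_edgeHeight {c : ℝ≥0∞}
    (hc : ∀ x ∈ A, ∀ y ∈ B, 0 < q x y → c ≤ (max (h x) (h y) : ℝ≥0)) :
    c ≤ edgeHeight h q A B :=
  le_iInf₂ fun p hp => hc p.1 hp.1 p.2 hp.2.1 hp.2.2

theorem edgeHeight_anti {A' B' : Set S} (hA : A ⊆ A') (hB : B ⊆ B') :
    edgeHeight h q A' B' ≤ edgeHeight h q A B :=
  le_edgeHeight fun _ hx _ hy hxy => edgeHeight_le (hA hx) (hB hy) hxy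

theorem edgeHeight_comm (hsym : ∀ x y, q x y = q y x) (A B : Set S) :
    edgeHeight h q A B = edgeHeight h q B A := by
  have key : ∀ A B : Set S, edgeHeight h q A B ≤ edgeHeight h q B A := fun A B =>
    le_edgeHeight fun x hx y hy hxy => by
      rw [max_comm]
      exact edgeHeight_le hy hx (hsym x y ▸ hxy)
  exact le_antisymm (key A B) (key B A)

theorem bottom_le_edgeHeight : bottom h A ≤ edgeHeight h q A B :=
  le_edgeHeight fun x hx _ _ _ =>
    (iInf₂_le x hx).trans (ENNReal.coe_le_coe.2 (le_max_left _ _))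

theorem exists_edge_of_edgeHeight_ne_top (hAB : edgeHeight h q A B ≠ ⊤) :
    ∃ x ∈ A, ∃ y ∈ B, 0 < q x y ∧ edgeHeight h q A B = (max (h x) (h y) : ℝ≥0) := by
  have hne : Nonempty (S × S) := by
    by_contra hempty
    rw [not_nonempty_iff] at hempty
    exact hAB (iInf_of_empty _)
  obtain ⟨p, hp⟩ := exists_eq_ciInf_of_finite (f := fun p : S × S =>
    ⨅ _ : p.1 ∈ A ∧ p.2 ∈ B ∧ 0 < q p.1 p.2, ((max (h p.1) (h p.2) : ℝ≥0) : ℝ≥0∞))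
  change _ = edgeHeight h q A B at hp
  by_cases hc : p.1 ∈ A ∧ p.2 ∈ B ∧ 0 < q p.1 p.2
  · refine ⟨p.1, hc.1, p.2, hc.2.1, hc.2.2, ?_⟩
    rw [← hp, iInf_pos hc]
  · rw [iInf_neg hc] at hp
    exact absurd hp.symm hAB

theorem exitHeight_ne_top (hirr : ∀ x y : S, JoinedIn q Set.univ x y) (hA : A.Nonempty)
    (hA' : A ≠ Set.univ) : exitHeight h q A ≠ ⊤ := by
  obtain ⟨x, hx⟩ := hA
  obtain ⟨y, hy⟩ := (Set.ne_univ_iff_exists_notMem A).1 hA'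
  obtain ⟨a, ha, b, hb, -, -, hab⟩ := (hirr x y).exists_crossing hx hy
  exact ne_top_of_le_ne_top ENNReal.coe_ne_top (edgeHeight_le ha hb hab)

end Heights

section Partition

variable {E : Set (Set S)} {A B : Set S} {x : S}

theorem _root_.Setoid.IsPartition.eq_of_mem (hE : Setoid.IsPartition E) (hA : A ∈ E) (hB : B ∈ E)
    (hxA : x ∈ A) (hxB : x ∈ B) : A = B :=
  (hE.2 x).unique ⟨hA, hxA⟩ ⟨hB, hxB⟩

theorem _root_.Setoid.IsPartition.nonempty (hE : Setoid.IsPartition E) (hA : A ∈ E) :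
    A.Nonempty :=
  Setoid.nonempty_of_mem_partition hE hA

theorem _root_.Setoid.IsPartition.exists_mem (hE : Setoid.IsPartition E) (x : S) :
    ∃ A ∈ E, x ∈ A :=
  (hE.2 x).exists

theorem _root_.Setoid.IsPartition.disjoint (hE : Setoid.IsPartition E) (hA : A ∈ E) (hB : B ∈ E)
    (hAB : A ≠ B) : Disjoint A B :=
  Set.disjoint_left.2 fun _ hxA hxB => hAB (hE.eq_of_mem hA hB hxA hxB)

end Partition

section Level

variable {h : S → ℝ≥0} {q : S → S → ℝ} {E : Set (Set S)} {V : Set S → Set S → ℝ≥0∞}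
  {A B : Set S}

theorem exitHeight_le_edgeHeight (hE : Setoid.IsPartition E) (hA : A ∈ E) (hB : B ∈ E)
    (hAB : A ≠ B) : exitHeight h q A ≤ edgeHeight h q A B :=
  edgeHeight_anti subset_rfl (hE.disjoint hA hB hAB).subset_compl_left

theorem exitHeight_eq_iInf (hE : Setoid.IsPartition E) (hA : A ∈ E) :
    exitHeight h q A = ⨅ B ∈ E \ {A}, edgeHeight h q A B := by
  apply le_antisymm
  · exact le_iInf₂ fun B hB => exitHeight_le_edgeHeight hE hA hB.1 (Ne.symm hB.2)
  · refine le_edgeHeight fun x hx y hy hxy => ?_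
    obtain ⟨B, hB, hyB⟩ := hE.exists_mem y
    exact (iInf₂_le B ⟨hB, fun hBA => hy (hBA ▸ hyB)⟩).trans (edgeHeight_le hx hyB hxy)

theorem exists_step (hE : Setoid.IsPartition E) (hA : A ∈ E) (htop : exitHeight h q A ≠ ⊤) :
    ∃ B, Step h q E A B := by
  obtain ⟨x, hx, y, hy, hxy, heq⟩ := exists_edge_of_edgeHeight_ne_top htop
  obtain ⟨B, hB, hyB⟩ := hE.exists_mem y
  exact ⟨B, hA, hB, fun hAB => hy (hAB ▸ hyB), (edgeHeight_le hx hyB hxy).trans heq.ge⟩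

theorem Step.exitHeight_le (hsym : ∀ x y, q x y = q y x) (hE : Setoid.IsPartition E)
    (hs : Step h q E A B) : exitHeight h q B ≤ exitHeight h q A := by
  obtain ⟨hA, hB, hAB, hle⟩ := hs
  calc exitHeight h q B ≤ edgeHeight h q B A := exitHeight_le_edgeHeight hE hB hA hAB.symm
    _ = edgeHeight h q A B := edgeHeight_comm hsym _ _
    _ ≤ _ := hle

theorem exitHeight_le_of_reflTransGen (hsym : ∀ x y, q x y = q y x)
    (hE : Setoid.IsPartition E) (hs : Relation.ReflTransGen (Step h q E) A B) :
    exitHeight h q B ≤ exitHeight h q A := by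
  induction hs with
  | refl => exact le_rfl
  | tail _ h2 ih => exact (h2.exitHeight_le hsym hE).trans ih

theorem reflTransGen_symm_of_minimal (hsym : ∀ x y, q x y = q y x) (hE : Setoid.IsPartition E)
    (hmin : ∀ C ∈ E, exitHeight h q A ≤ exitHeight h q C)
    (hs : Relation.ReflTransGen (Step h q E) A B) :
    Relation.ReflTransGen (Step h q E) B A := by
  induction hs with
  | refl => exact .refl
  | tail h1 h2 ih =>
    refine .head ⟨h2.2.1, h2.1, h2.2.2.1.symm, ?_⟩ ih
    rw [edgeHeight_comm hsym]
    exact h2.2.2.2.trans ((exitHeight_le_of_reflTransGen hsym hE h1).trans (hmin _ h2.2.1))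

namespace IsLevel

theorem heAux_eq (hL : IsLevel h q E V) (hA : A ∈ E) :
    HeAux E V A = exitHeight h q A - bottom h A := by
  rw [exitHeight_eq_iInf hL.isPartition hA, HeAux]
  simp only [iInf_subtype', ENNReal.iInf_tsub _ (bottom_ne_top (hL.isPartition.nonempty hA))]
  exact iInf_congr fun B => hL.cost A hA B B.2.1 (Ne.symm B.2.2)

theorem vsAux_eq (hL : IsLevel h q E V) (hA : A ∈ E) (hB : B ∈ E) (hAB : A ≠ B) :
    VsAux E V A B = edgeHeight h q A B - exitHeight h q A := by
  rw [VsAux, hL.heAux_eq hA, hL.cost A hA B hB hAB, tsub_tsub, add_tsub_cancel_of_le]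
  exact bottom_le_edgeHeight

theorem arrowAux_iff (hL : IsLevel h q E V) (hA : A ∈ E) :
    arrowAux E V A B ↔ Relation.ReflTransGen (Step h q E) A B := by
  constructor
  · rintro ⟨l, h1, h2, h3, h4⟩
    induction l generalizing A with
    | nil => simp at h1
    | cons C l ih =>
      obtain rfl : C = A := by simpa using h1
      cases l with
      | nil =>
        obtain rfl : C = B := by simpa using h2
        exact .refl
      | cons D l =>
        rw [listCost, add_eq_zero] at h4
        have hD : D ∈ E := h3 D (by simp)
        have hDB := ih hD (by simp) (by simpa using h2) (fun X hX => h3 X (by simp [hX])) h4.2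
        rcases eq_or_ne C D with rfl | hCD
        · exact hDB
        · refine .head ⟨hA, hD, hCD, ?_⟩ hDB
          have hcost := h4.1
          rwa [hL.vsAux_eq hA hD hCD, tsub_eq_zero_iff_le] at hcost
  · intro hs
    induction hs using Relation.ReflTransGen.head_induction_on with
    | refl => exact ⟨[B], by simp [listCost, hA]⟩
    | @head X Y hstep _ ih =>
      obtain ⟨hX, hY, hXY, hle⟩ := hstep
      obtain ⟨l, h1, h2, h3, h4⟩ := ih hY
      cases l with
      | nil => simp at h1
      | cons C l =>
        obtain rfl : C = Y := by simpa using h1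
        refine ⟨X :: C :: l, by simp, by simpa using h2, ?_, ?_⟩
        · intro Z hZ
          rcases List.mem_cons.1 hZ with rfl | hZ
          · exact hX
          · exact h3 Z hZ
        · rw [listCost, h4, add_zero, hL.vsAux_eq hX hY hXY, tsub_eq_zero_iff_le]
          exact hle

theorem subset_mergedClass (hL : IsLevel h q E V) (hA : A ∈ E) : A ⊆ mergedClass E V A :=
  Set.subset_sUnion_of_mem ⟨hA, (hL.arrowAux_iff hA).2 .refl, (hL.arrowAux_iff hA).2 .refl⟩

theorem mergedClass_mem_DAux (hA : A ∈ E) : mergedClass E V A ∈ DAux E V := ⟨A, hA, rfl⟩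

theorem mergedClass_eq (hL : IsLevel h q E V) (hA : A ∈ E) (hB : B ∈ E)
    (h1 : arrowAux E V A B) (h2 : arrowAux E V B A) : mergedClass E V A = mergedClass E V B := by
  rw [hL.arrowAux_iff hA] at h1
  rw [hL.arrowAux_iff hB] at h2
  unfold mergedClass
  congr 1
  ext C
  refine and_congr_right fun hC => ?_
  rw [hL.arrowAux_iff hA, hL.arrowAux_iff hC, hL.arrowAux_iff hB, hL.arrowAux_iff hC]
  exact ⟨fun hc => ⟨h2.trans hc.1, hc.2.trans h1⟩, fun hc => ⟨h1.trans hc.1, hc.2.trans h2⟩⟩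

theorem arrowAux_of_mem_mergedClass (hL : IsLevel h q E V) (hB : B ∈ E) {x : S} (hxB : x ∈ B)
    (hx : x ∈ mergedClass E V A) : arrowAux E V A B ∧ arrowAux E V B A := by
  obtain ⟨C, ⟨hC, hAC⟩, hxC⟩ := hx
  obtain rfl := hL.isPartition.eq_of_mem hC hB hxC hxB
  exact hAC

theorem eq_mergedClass (hL : IsLevel h q E V) {D : Set S} (hD : D ∈ DAux E V) (hA : A ∈ E)
    {x : S} (hxA : x ∈ A) (hxD : x ∈ D) : D = mergedClass E V A := by
  obtain ⟨B, hB, rfl⟩ := hD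
  obtain ⟨h1, h2⟩ := hL.arrowAux_of_mem_mergedClass hA hxA hxD
  exact hL.mergedClass_eq hB hA h1 h2

theorem EnextAux_cases (hL : IsLevel h q E V) {P : Set S} (hP : P ∈ EnextAux E V) (hA : A ∈ E)
    {x : S} (hxA : x ∈ A) (hxP : x ∈ P) :
    (mergedClass E V A ∈ DstarAux E V ∧ P = mergedClass E V A) ∨
      (mergedClass E V A ∉ DstarAux E V ∧ P = A) := by
  rcases hP with hP | ⟨hP, D, ⟨hD, hD'⟩, hPD⟩
  · have heq := hL.eq_mergedClass hP.1 hA hxA hxP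
    exact .inl ⟨heq ▸ hP, heq⟩
  · have heq := hL.eq_mergedClass hD hA hxA (hPD hxP)
    exact .inr ⟨heq ▸ hD', hL.isPartition.eq_of_mem hP hA hxP hxA⟩

theorem isPartition_next (hL : IsLevel h q E V) : Setoid.IsPartition (EnextAux E V) := by
  constructor
  · rintro (⟨⟨A, hA, hempty⟩, -⟩ | ⟨hmem, -⟩)
    · obtain ⟨x, hx⟩ := hL.isPartition.nonempty hA
      exact Set.notMem_empty x (hempty ▸ hL.subset_mergedClass hA hx)
    · exact hL.isPartition.1 hmem
  · intro x
    obtain ⟨A, hA, hxA⟩ := hL.isPartition.exists_mem x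
    have hxD := hL.subset_mergedClass hA hxA
    by_cases hD : mergedClass E V A ∈ DstarAux E V
    · refine ⟨_, ⟨.inl hD, hxD⟩, fun P hP => ?_⟩
      rcases hL.EnextAux_cases hP.1 hA hxA hP.2 with hc | hc
      · exact hc.2
      · exact absurd hD hc.1
    · refine ⟨A, ⟨.inr ⟨hA, _, ⟨mergedClass_mem_DAux hA, hD⟩, hL.subset_mergedClass hA⟩, hxA⟩,
        fun P hP => ?_⟩
      rcases hL.EnextAux_cases hP.1 hA hxA hP.2 with hc | hc
      · exact absurd hc.1 hD
      · exact hc.2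

theorem subset_of_mem_EnextAux (hL : IsLevel h q E V) {P : Set S} (hP : P ∈ EnextAux E V)
    (hA : A ∈ E) {x : S} (hxA : x ∈ A) (hxP : x ∈ P) : A ⊆ P := by
  rcases hL.EnextAux_cases hP hA hxA hxP with ⟨-, rfl⟩ | ⟨-, rfl⟩
  · exact hL.subset_mergedClass hA
  · exact subset_rfl

theorem exitHeight_eq_of_subset (hsym : ∀ x y, q x y = q y x) (hL : IsLevel h q E V) {P : Set S}
    (hP : P ∈ EnextAux E V) (hA : A ∈ E) (hB : B ∈ E) (hAP : A ⊆ P) (hBP : B ⊆ P) :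
    exitHeight h q A = exitHeight h q B := by
  obtain ⟨x, hx⟩ := hL.isPartition.nonempty hA
  obtain ⟨y, hy⟩ := hL.isPartition.nonempty hB
  rcases hL.EnextAux_cases hP hA hx (hAP hx) with ⟨-, rfl⟩ | ⟨-, rfl⟩
  · obtain ⟨h1, h2⟩ := hL.arrowAux_of_mem_mergedClass hB hy (hBP hy)
    exact le_antisymm
      (exitHeight_le_of_reflTransGen hsym hL.isPartition ((hL.arrowAux_iff hB).1 h2))
      (exitHeight_le_of_reflTransGen hsym hL.isPartition ((hL.arrowAux_iff hA).1 h1))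
  · rw [hL.isPartition.eq_of_mem hA hB (hBP hy) hy]

theorem bottom_eq_iInf (hL : IsLevel h q E V) {P : Set S} (hP : P ∈ EnextAux E V) :
    bottom h P = ⨅ B ∈ {B | B ∈ E ∧ B ⊆ P}, bottom h B := by
  apply le_antisymm
  · exact le_iInf₂ fun B hB => biInf_mono hB.2
  · refine le_iInf₂ fun x hx => ?_
    obtain ⟨B, hB, hxB⟩ := hL.isPartition.exists_mem x
    exact (iInf₂_le B ⟨hB, hL.subset_of_mem_EnextAux hP hB hxB hx⟩).trans (iInf₂_le x hxB)

theorem edgeHeight_eq_iInf (hL : IsLevel h q E V) {P Q : Set S} (hP : P ∈ EnextAux E V)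
    (hQ : Q ∈ EnextAux E V) :
    edgeHeight h q P Q =
      ⨅ B ∈ {B | B ∈ E ∧ B ⊆ P}, ⨅ B' ∈ {B' | B' ∈ E ∧ B' ⊆ Q}, edgeHeight h q B B' := by
  apply le_antisymm
  · exact le_iInf₂ fun B hB => le_iInf₂ fun B' hB' => edgeHeight_anti hB.2 hB'.2
  · refine le_edgeHeight fun x hx y hy hxy => ?_
    obtain ⟨B, hB, hxB⟩ := hL.isPartition.exists_mem x
    obtain ⟨B', hB', hyB'⟩ := hL.isPartition.exists_mem y
    exact (iInf₂_le B ⟨hB, hL.subset_of_mem_EnextAux hP hB hxB hx⟩).trans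
      ((iInf₂_le B' ⟨hB', hL.subset_of_mem_EnextAux hQ hB' hyB' hy⟩).trans
        (edgeHeight_le hxB hyB' hxy))

theorem next (hsym : ∀ x y, q x y = q y x) (hirr : ∀ x y : S, JoinedIn q Set.univ x y)
    (hL : IsLevel h q E V) : IsLevel h q (EnextAux E V) (VnextAux E V) := by
  refine ⟨hL.isPartition_next, fun P hP Q hQ hPQ => ?_⟩
  have hdisj : Disjoint P Q := hL.isPartition_next.disjoint hP hQ hPQ
  obtain ⟨x, hx⟩ := hL.isPartition_next.nonempty hP
  obtain ⟨y, hy⟩ := hL.isPartition_next.nonempty hQ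
  obtain ⟨A, hA, hxA⟩ := hL.isPartition.exists_mem x
  have hAP := hL.subset_of_mem_EnextAux hP hA hxA hx
  set c := exitHeight h q A with hc
  have hctop : c ≠ ⊤ := exitHeight_ne_top hirr ⟨x, hxA⟩ fun hAu =>
    Set.disjoint_left.1 hdisj (hAP (hAu ▸ Set.mem_univ y)) hy
  have hcB : ∀ B ∈ E, B ⊆ P → exitHeight h q B = c := fun B hB hBP =>
    hL.exitHeight_eq_of_subset hsym hP hB hA hBP hAP
  have hne : ∀ B ∈ E, B ⊆ P → ∀ B' ⊆ Q, B ≠ B' := by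
    rintro B hB hBP B' hBQ rfl
    obtain ⟨z, hz⟩ := hL.isPartition.nonempty hB
    exact Set.disjoint_left.1 hdisj (hBP hz) (hBQ hz)
  have hHm : HmAux E V P = c - bottom h P := by
    rw [HmAux, hL.bottom_eq_iInf hP]
    simp only [iInf_subtype', iSup_subtype', ENNReal.sub_iInf]
    exact iSup_congr fun B => by rw [hL.heAux_eq B.2.1, hcB B B.2.1 B.2.2]
  have hinf : ⨅ B ∈ {B | B ∈ E ∧ B ⊆ P}, ⨅ B' ∈ {B' | B' ∈ E ∧ B' ⊆ Q}, VsAux E V B B' =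
      edgeHeight h q P Q - c := by
    rw [hL.edgeHeight_eq_iInf hP hQ]
    simp only [iInf_subtype', ENNReal.iInf_tsub _ hctop]
    refine iInf_congr fun B => iInf_congr fun B' => ?_
    rw [hL.vsAux_eq B.2.1 B'.2.1 (hne B B.2.1 B.2.2 B' B'.2.2), hcB B B.2.1 B.2.2]
  have hbc : bottom h P ≤ c :=
    le_trans (biInf_mono hAP : bottom h P ≤ bottom h A) bottom_le_edgeHeight
  have hcU : c ≤ edgeHeight h q P Q := by
    rw [hL.edgeHeight_eq_iInf hP hQ]
    refine le_iInf₂ fun B hB => le_iInf₂ fun B' hB' => ?_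
    rw [← hcB B hB.1 hB.2]
    exact exitHeight_le_edgeHeight hL.isPartition hB.1 hB'.1 (hne B hB.1 hB.2 B' hB'.2)
  rw [VnextAux, hHm, hinf, add_comm, tsub_add_tsub_cancel hcU hbc]

theorem ncard_next_lt (hsym : ∀ x y, q x y = q y x) (hirr : ∀ x y : S, JoinedIn q Set.univ x y)
    (hL : IsLevel h q E V) (hE : E.Nontrivial) : (EnextAux E V).ncard < E.ncard := by
  classical
  obtain ⟨A, hA, hmin⟩ := Set.exists_min_image E (exitHeight h q) E.toFinite hE.nonempty
  have htop : exitHeight h q A ≠ ⊤ := by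
    refine exitHeight_ne_top hirr (hL.isPartition.nonempty hA) fun hAu => ?_
    obtain ⟨C, hC, hCA⟩ := hE.exists_ne A
    obtain ⟨x, hx⟩ := hL.isPartition.nonempty hC
    exact hCA (hL.isPartition.eq_of_mem hC hA hx (hAu ▸ Set.mem_univ x))
  obtain ⟨B, hAB⟩ := exists_step hL.isPartition hA htop
  have hB : B ∈ E := hAB.2.1
  have hback : ∀ {C}, C ∈ E → arrowAux E V A C → arrowAux E V C A := fun hC hAC =>
    (hL.arrowAux_iff hC).2 (reflTransGen_symm_of_minimal hsym hL.isPartition hmin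
      ((hL.arrowAux_iff hA).1 hAC))
  have hAB' : arrowAux E V A B := (hL.arrowAux_iff hA).2 (.single hAB)
  have heq : mergedClass E V A = mergedClass E V B := hL.mergedClass_eq hA hB hAB' (hback hB hAB')
  have hstar : mergedClass E V A ∈ DstarAux E V := by
    refine ⟨mergedClass_mem_DAux hA, ?_⟩
    rintro D hD ⟨C, hC, C', hC', hCA, hCD, hCC'⟩
    obtain ⟨x, hx⟩ := hL.isPartition.nonempty hC
    obtain ⟨y, hy⟩ := hL.isPartition.nonempty hC'
    have hAC := (hL.arrowAux_of_mem_mergedClass hC hx (hCA hx)).1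
    have hAC' : arrowAux E V A C' := (hL.arrowAux_iff hA).2
      (((hL.arrowAux_iff hA).1 hAC).trans ((hL.arrowAux_iff hC).1 hCC'))
    rw [hL.eq_mergedClass hD hC' hy (hCD hy), hL.mergedClass_eq hA hC' hAC' (hback hC' hAC')]
  let f : Set S → Set S := fun C =>
    if mergedClass E V C ∈ DstarAux E V then mergedClass E V C else C
  have hsub : EnextAux E V ⊆ f '' (E \ {B}) := by
    intro P hP
    obtain ⟨x, hx⟩ := hL.isPartition_next.nonempty hP
    obtain ⟨C, hC, hxC⟩ := hL.isPartition.exists_mem x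
    have hfC : f C = P := by
      rcases hL.EnextAux_cases hP hC hxC hx with ⟨h1, h2⟩ | ⟨h1, h2⟩
      · simp only [f, if_pos h1, h2]
      · simp only [f, if_neg h1, h2]
    rcases eq_or_ne C B with rfl | hCB
    · refine ⟨A, ⟨hA, hAB.2.2.1⟩, ?_⟩
      rw [← hfC]
      simp only [f, heq]
      rw [if_pos (heq ▸ hstar), if_pos (heq ▸ hstar)]
    · exact ⟨C, ⟨hC, hCB⟩, hfC⟩
  calc (EnextAux E V).ncard ≤ (f '' (E \ {B})).ncard := Set.ncard_le_ncard hsub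
    _ ≤ (E \ {B}).ncard := Set.ncard_image_le
    _ < E.ncard := Set.ncard_sdiff_singleton_lt_of_mem hB

theorem compatible_next (hL : IsLevel h q E V) {G : Set S} (hconn : IsConnectedSet q G)
    (hG : ∀ x ∈ G, ∀ y ∈ extBoundary q G, h x < h y) (hcomp : Compatible E G) (hGE : G ∉ E) :
    Compatible (EnextAux E V) G := by
  have hstep : ∀ {A B}, Step h q E A B → A ⊆ G → B ⊆ G := by
    rintro A B ⟨hA, hB, hAB, hle⟩ hAG
    obtain ⟨x, hx⟩ := hL.isPartition.nonempty hA
    obtain ⟨y, hyG, hyA⟩ : ∃ y ∈ G, y ∉ A := by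
      by_contra! hGA
      exact hGE (hAG.antisymm hGA ▸ hA)
    obtain ⟨a, ha, b, hb, haG, hbG, hab⟩ := (hconn x (hAG hx) y hyG).exists_crossing hx hyA
    have hle' := hle.trans (edgeHeight_le ha hb hab)
    obtain ⟨a', ha', b', hb', hab', heq⟩ :=
      exists_edge_of_edgeHeight_ne_top (ne_top_of_le_ne_top ENNReal.coe_ne_top hle')
    rw [heq, ENNReal.coe_le_coe] at hle'
    refine hcomp B hB ⟨b', hb', ?_⟩
    by_contra hb'G
    have hbd : b' ∈ extBoundary q G := ⟨hb'G, a', hAG ha', hab'⟩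
    exact ((le_max_right _ _).trans hle').not_gt (max_lt (hG a haG b' hbd) (hG b hbG b' hbd))
  intro P hP ⟨x, hxP, hxG⟩
  obtain ⟨A, hA, hxA⟩ := hL.isPartition.exists_mem x
  have hAG : A ⊆ G := hcomp A hA ⟨x, hxA, hxG⟩
  rcases hL.EnextAux_cases hP hA hxA hxP with ⟨-, rfl⟩ | ⟨-, rfl⟩
  · refine Set.sUnion_subset fun B hB => ?_
    have hs := (hL.arrowAux_iff hA).1 hB.2.1
    clear hB
    induction hs with
    | refl => exact hAG
    | tail _ h2 ih => exact hstep h2 ih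
  · exact hAG

end IsLevel

end Level

theorem isLevel_zero {H : S → ℝ} {h : S → ℝ≥0} {c : ℝ} (hH : ∀ x, H x = h x + c)
    (q : S → S → ℝ) : IsLevel h q (Ecyc H q 0) (Vcyc H q 0) := by
  refine ⟨⟨?_, fun x => ⟨{x}, ⟨⟨x, rfl⟩, rfl⟩, ?_⟩⟩, ?_⟩
  · rintro ⟨i, hi⟩
    exact Set.singleton_ne_empty i hi.symm
  · rintro _ ⟨⟨i, rfl⟩, hx⟩
    rw [Set.mem_singleton_iff.1 hx]
  · rintro _ ⟨i, rfl⟩ _ ⟨j, rfl⟩ -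
    have hbot : bottom h {i} = h i := by simp [bottom]
    have hV : Vcyc H q 0 {i} {j} = ⨅ _ : 0 < q i j, ENNReal.ofReal (H j - H i) := by
      simp [Vcyc, cycEV, V0]
    rw [hV, hbot]
    by_cases hij : 0 < q i j
    · have hU : edgeHeight h q {i} {j} = (max (h i) (h j) : ℝ≥0) :=
        le_antisymm (edgeHeight_le rfl rfl hij) (le_edgeHeight fun x hx y hy _ => by
          rw [Set.mem_singleton_iff.1 hx, Set.mem_singleton_iff.1 hy])
      have hsub : H j - H i = h j - h i := by rw [hH, hH]; ring
      rw [iInf_pos hij, hU, hsub, ← ENNReal.coe_sub, ENNReal.ofReal, ← NNReal.sub_def]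
      congr 1
      rcases le_total (h i) (h j) with hle | hle
      · rw [max_eq_right hle]
      · rw [max_eq_left hle, tsub_self, tsub_eq_zero_of_le hle]
    · have hU : edgeHeight h q {i} {j} = ⊤ := top_le_iff.1 (le_edgeHeight fun x hx y hy hxy => by
        rw [Set.mem_singleton_iff.1 hx, Set.mem_singleton_iff.1 hy] at hxy
        exact absurd hxy hij)
      rw [iInf_neg hij, hU, ENNReal.top_sub_coe]

theorem isLevel_cyc {H : S → ℝ} {h : S → ℝ≥0} {c : ℝ} (hH : ∀ x, H x = h x + c)
    {q : S → S → ℝ} (hsym : ∀ x y, q x y = q y x)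
    (hirr : ∀ x y : S, JoinedIn q Set.univ x y) (k : ℕ) :
    IsLevel h q (Ecyc H q k) (Vcyc H q k) := by
  induction k with
  | zero => exact isLevel_zero hH q
  | succ k ih => exact ih.next hsym hirr

/-- Every path cycle is a graph cycle. -/
theorem pathCycle_isGraphCycle (H : S → ℝ) (q : S → S → ℝ)
    (hq : ∀ x y : S, 0 ≤ q x y ∧ q x y ≤ 1)
    (hsum : ∀ x : S, ∑ y ∈ Finset.univ.erase x, q x y ≤ 1)
    (hsym : ∀ x y : S, q x y = q y x)
    (hirr : ∀ x y : S, JoinedIn q Set.univ x y)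
    (A : Set S) (hA : IsPathCycle H q A) :
    A ∈ GraphCycles H q := by
  rcases hA with ⟨x, rfl⟩ | ⟨⟨x, hx⟩, hconn, hlt⟩
  · exact ⟨0, x, rfl⟩
  by_contra hnot
  have hnotE : ∀ k, A ∉ Ecyc H q k := fun k hk => hnot ⟨k, hk⟩
  have : Nonempty S := ⟨x⟩
  obtain ⟨m, hm⟩ := Finite.exists_min H
  let h : S → ℝ≥0 := fun z => ⟨H z - H m, sub_nonneg.2 (hm z)⟩
  have hH : ∀ z, H z = h z + H m := fun z => (sub_add_cancel (H z) (H m)).symm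
  have hL := isLevel_cyc hH hsym hirr
  have hlt' : ∀ a ∈ A, ∀ b ∈ extBoundary q A, h a < h b := fun a ha b hb =>
    NNReal.coe_lt_coe.1 (sub_lt_sub_right (hlt a ha b hb) (H m))
  have hcomp : ∀ k, Compatible (Ecyc H q k) A := by
    intro k
    induction k with
    | zero =>
      rintro _ ⟨i, rfl⟩ ⟨z, rfl, hz⟩
      exact Set.singleton_subset_iff.2 hz
    | succ k ih => exact (hL k).compatible_next hconn hlt' ih (hnotE k)
  have hnontriv : ∀ k, (Ecyc H q k).Nontrivial := by
    intro k
    by_contra hk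
    rw [Set.not_nontrivial_iff] at hk
    obtain ⟨B, hB, hxB⟩ := (hL k).isPartition.exists_mem x
    have hAB : A ⊆ B := fun y _ => by
      obtain ⟨C, hC, hyC⟩ := (hL k).isPartition.exists_mem y
      exact hk hC hB ▸ hyC
    exact hnotE k (hAB.antisymm (hcomp k B hB ⟨x, hxB, hx⟩) ▸ hB)
  have hcard : ∀ k, (Ecyc H q k).ncard + k ≤ (Ecyc H q 0).ncard := by
    intro k
    induction k with
    | zero => exact le_rfl
    | succ k ih =>
      have hdec : (Ecyc H q (k + 1)).ncard < (Ecyc H q k).ncard :=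
        (hL k).ncard_next_lt hsym hirr (hnontriv k)
      omega
  have := hcard ((Ecyc H q 0).ncard + 1)
  omega

end MetropolisCycles
end

section
/- For every n ≥ 0, if A ∈ E^n with |A| > 1 and {a} ∈ E^n is a singleton connected to A (i.e. a ∈ ∂A), then V^n(A,{a}) = H(a) − min_A H and V^n({a},A) = 0. -/
open scoped ENNReal

namespace MetropolisCycles

variable {S : Type*} [Fintype S] [DecidableEq S]

/-- One zero-cost step between two elements of `E`. -/
def ZeroStep (E : Set (Set S)) (V : Set S → Set S → ℝ≥0∞) (A B : Set S) : Prop :=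
  A ∈ E ∧ B ∈ E ∧ VsAux E V A B = 0

/-- The cheapest way, counted from the base energy `c`, of jumping from `A` into `B`. -/
noncomputable def jumpCost (H : S → ℝ) (q : S → S → ℝ) (c : ℝ) (A B : Set S) : ℝ≥0∞ :=
  ⨅ p : {p : S × S // p.1 ∈ A ∧ p.2 ∈ B ∧ 0 < q p.1 p.2}, ENNReal.ofReal (H p.1.2 - c)

/-- The energy level at which `A` is left: the larger of `min_A H` and `min_{∂A} H`. -/
noncomputable def exitLevel (H : S → ℝ) (q : S → S → ℝ) (A : Set S) : ℝ :=
  max (sInf (H '' A)) (sInf (H '' extBoundary q A))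

/-- The union of the equivalence class of `A` for the relation `→` in both directions. -/
def arrowClass (E : Set (Set S)) (V : Set S → Set S → ℝ≥0∞) (A : Set S) : Set S :=
  ⋃₀ {A' | A' ∈ E ∧ arrowAux E V A A' ∧ arrowAux E V A' A}

/-- The properties of a level `(E, V)` which propagate through the construction. -/
structure IsCycleLevel (H : S → ℝ) (q : S → S → ℝ) (E : Set (Set S))
    (V : Set S → Set S → ℝ≥0∞) : Prop where
  nonempty : ∀ A ∈ E, A.Nonempty
  eq_of_mem : ∀ A ∈ E, ∀ B ∈ E, ∀ x, x ∈ A → x ∈ B → A = B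
  cover : ∀ x, ∃ A ∈ E, x ∈ A
  lt_boundary : ∀ A ∈ E, A.Nontrivial → ∀ x ∈ A, ∀ y ∈ extBoundary q A, H x < H y
  cost : ∀ A ∈ E, ∀ B ∈ E, A ≠ B → V A B = jumpCost H q (sInf (H '' A)) A B

section Energy

variable {H : S → ℝ} {q : S → S → ℝ} {A B : Set S} {x y : S}

omit [DecidableEq S] in
theorem sInf_image_le (hx : x ∈ A) : sInf (H '' A) ≤ H x :=
  csInf_le (Set.toFinite _).bddBelow ⟨x, hx, rfl⟩

omit [DecidableEq S] in
theorem exists_eq_sInf_image (hA : A.Nonempty) : ∃ x ∈ A, H x = sInf (H '' A) :=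
  (hA.image H).csInf_mem (Set.toFinite _)

omit [DecidableEq S] in
theorem sInf_image_le_of_subset (hB : B.Nonempty) (hBA : B ⊆ A) :
    sInf (H '' A) ≤ sInf (H '' B) := by
  obtain ⟨x, hx, hxe⟩ := exists_eq_sInf_image (H := H) hB
  exact hxe ▸ sInf_image_le (hBA hx)

omit [Fintype S] [DecidableEq S] in
theorem sInf_image_le_exitLevel : sInf (H '' A) ≤ exitLevel H q A := le_max_left _ _

omit [Fintype S] [DecidableEq S] in
theorem jumpCost_le {c : ℝ} (hx : x ∈ A) (hy : y ∈ B) (hxy : 0 < q x y) :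
    jumpCost H q c A B ≤ ENNReal.ofReal (H y - c) :=
  iInf_le (fun p : {p : S × S // p.1 ∈ A ∧ p.2 ∈ B ∧ 0 < q p.1 p.2} =>
    ENNReal.ofReal (H p.1.2 - c)) ⟨(x, y), hx, hy, hxy⟩

omit [Fintype S] [DecidableEq S] in
theorem le_jumpCost {c : ℝ} {r : ℝ≥0∞}
    (h : ∀ x ∈ A, ∀ y ∈ B, 0 < q x y → r ≤ ENNReal.ofReal (H y - c)) :
    r ≤ jumpCost H q c A B :=
  le_iInf fun p => h _ p.2.1 _ p.2.2.1 p.2.2.2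

omit [DecidableEq S] in
theorem jumpCost_eq_zero_iff {c : ℝ} :
    jumpCost H q c A B = 0 ↔ ∃ x ∈ A, ∃ y ∈ B, 0 < q x y ∧ H y ≤ c := by
  constructor
  · intro h
    rcases isEmpty_or_nonempty {p : S × S // p.1 ∈ A ∧ p.2 ∈ B ∧ 0 < q p.1 p.2} with he | hne
    · simp [jumpCost, iInf_of_empty] at h
    · obtain ⟨p, hp⟩ := exists_eq_ciInf_of_finite
        (f := fun p : {p : S × S // p.1 ∈ A ∧ p.2 ∈ B ∧ 0 < q p.1 p.2} =>
          ENNReal.ofReal (H p.1.2 - c))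
      have h0 : ENNReal.ofReal (H p.1.2 - c) = 0 := hp.trans h
      rw [ENNReal.ofReal_eq_zero] at h0
      exact ⟨_, p.2.1, _, p.2.2.1, p.2.2.2, by linarith⟩
  · rintro ⟨x, hx, y, hy, hxy, hc⟩
    refine le_antisymm ((jumpCost_le hx hy hxy).trans ?_) bot_le
    rw [ENNReal.ofReal_eq_zero.2 (by linarith)]

omit [DecidableEq S] in
theorem jumpCost_tsub {c d : ℝ} (hcd : c ≤ d) :
    jumpCost H q c A B - ENNReal.ofReal (d - c) = jumpCost H q d A B := by
  have hsub : ∀ z : ℝ, ENNReal.ofReal (z - c) - ENNReal.ofReal (d - c) =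
      ENNReal.ofReal (z - d) := fun z => by
    rw [← ENNReal.ofReal_sub _ (sub_nonneg.2 hcd), sub_sub_sub_cancel_right]
  rcases isEmpty_or_nonempty {p : S × S // p.1 ∈ A ∧ p.2 ∈ B ∧ 0 < q p.1 p.2} with he | hne
  · simp [jumpCost, iInf_of_empty]
  · rw [jumpCost, Finite.map_iInf_of_monotone _
      fun a b (hab : a ≤ b) => tsub_le_tsub_right hab (ENNReal.ofReal (d - c))]
    exact iInf_congr fun p => hsub _

omit [Fintype S] [DecidableEq S] in
theorem exists_crossing {ω : List S} (hx : x ∈ A) (hy : y ∉ A) (hhead : ω.head? = some x)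
    (hlast : ω.getLast? = some y) (hω : IsPath q ω) : (extBoundary q A).Nonempty := by
  induction ω generalizing x with
  | nil => simp at hhead
  | cons a l ih =>
    obtain rfl : a = x := by simpa using hhead
    cases l with
    | nil =>
      obtain rfl : a = y := by simpa using hlast
      exact absurd hx hy
    | cons b l =>
      have hω' : 0 < q a b ∧ IsPath q (b :: l) := List.isChain_cons_cons.1 hω
      by_cases hb : b ∈ A
      · exact ih hb rfl (by simpa using hlast) hω'.2
      · exact ⟨b, hb, a, hx, hω'.1⟩

omit [Fintype S] [DecidableEq S] in
theorem extBoundary_nonempty (hirr : ∀ x y : S, JoinedIn q Set.univ x y) (hx : x ∈ A)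
    (hy : y ∉ A) : (extBoundary q A).Nonempty := by
  obtain ⟨ω, h1, h2, h3, -⟩ := hirr x y
  exact exists_crossing hx hy h1 h2 h3

end Energy

section Arrow

variable {E : Set (Set S)} {V : Set S → Set S → ℝ≥0∞} {A B C : Set S}

omit [Fintype S] [DecidableEq S] in
theorem arrowAux_iff (hA : A ∈ E) :
    arrowAux E V A B ↔ Relation.ReflTransGen (ZeroStep E V) A B := by
  constructor
  · rintro ⟨l, hh, hl, hE, hc⟩
    induction l generalizing A with
    | nil => simp at hh
    | cons X l ih =>
      obtain rfl : X = A := by simpa using hh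
      cases l with
      | nil =>
        obtain rfl : X = B := by simpa using hl
        exact .refl
      | cons Y l =>
        simp only [listCost, add_eq_zero] at hc
        have hY : Y ∈ E := hE Y (by simp)
        exact .head ⟨hA, hY, hc.1⟩
          (ih hY rfl (by simpa using hl) (fun Z hZ => hE Z (by simp [hZ])) hc.2)
  · intro h
    induction h using Relation.ReflTransGen.head_induction_on with
    | refl =>
      have hB : B ∈ E := hA
      exact ⟨[B], rfl, rfl, by simpa using hB, rfl⟩
    | head hstep _ ih =>
      rename_i X Y _
      obtain ⟨l, hh, hl, hE, hc⟩ := ih hstep.2.1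
      cases l with
      | nil => simp at hh
      | cons Z l =>
        obtain rfl : Z = Y := by simpa using hh
        refine ⟨X :: Z :: l, rfl, by simpa using hl, ?_, ?_⟩
        · intro W hW
          rcases List.mem_cons.1 hW with rfl | hW
          · exact hstep.1
          · exact hE W hW
        · simp [listCost, hstep.2.2, hc]

omit [Fintype S] [DecidableEq S] in
theorem arrowAux_refl (hA : A ∈ E) : arrowAux E V A A := (arrowAux_iff hA).2 .refl

omit [Fintype S] [DecidableEq S] in
theorem arrowAux_trans (hA : A ∈ E) (hB : B ∈ E) (h : arrowAux E V A B)
    (h' : arrowAux E V B C) : arrowAux E V A C :=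
  (arrowAux_iff hA).2 (((arrowAux_iff hA).1 h).trans ((arrowAux_iff hB).1 h'))

omit [Fintype S] [DecidableEq S] in
theorem subset_arrowClass (hA : A ∈ E) : A ⊆ arrowClass E V A :=
  Set.subset_sUnion_of_mem ⟨hA, arrowAux_refl hA, arrowAux_refl hA⟩

omit [Fintype S] [DecidableEq S] in
theorem arrowClass_congr (hA : A ∈ E) (hB : B ∈ E) (h : arrowAux E V A B)
    (h' : arrowAux E V B A) : arrowClass E V A = arrowClass E V B := by
  unfold arrowClass
  congr 1
  ext C
  constructor
  · rintro ⟨hC, h1, h2⟩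
    exact ⟨hC, arrowAux_trans hB hA h' h1, arrowAux_trans hC hA h2 h⟩
  · rintro ⟨hC, h1, h2⟩
    exact ⟨hC, arrowAux_trans hA hB h h1, arrowAux_trans hC hB h2 h'⟩

end Arrow

namespace IsCycleLevel

variable {H : S → ℝ} {q : S → S → ℝ} {E : Set (Set S)} {V : Set S → Set S → ℝ≥0∞}
  {A B C X Y : Set S} {x y : S}

omit [Fintype S] [DecidableEq S] in
theorem exists_mem_extBoundary (h : IsCycleLevel H q E V)
    (hirr : ∀ x y : S, JoinedIn q Set.univ x y) (hA : A ∈ E) (hB : B ∈ E) (hAB : A ≠ B) :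
    (extBoundary q A).Nonempty := by
  obtain ⟨x, hx⟩ := h.nonempty A hA
  obtain ⟨y, hy⟩ := h.nonempty B hB
  exact extBoundary_nonempty hirr hx fun hyA => hAB (h.eq_of_mem A hA B hB y hyA hy)

omit [DecidableEq S] in
theorem heAux_eq (h : IsCycleLevel H q E V) (hA : A ∈ E) (hbd : (extBoundary q A).Nonempty) :
    HeAux E V A = ENNReal.ofReal (exitLevel H q A - sInf (H '' A)) := by
  apply le_antisymm
  · obtain ⟨y, ⟨hyA, x, hx, hxy⟩, hye⟩ := exists_eq_sInf_image (H := H) hbd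
    obtain ⟨B, hB, hyB⟩ := h.cover y
    have hAB : A ≠ B := by rintro rfl; exact hyA hyB
    refine (iInf₂_le B ⟨hB, fun e => hAB e.symm⟩).trans ?_
    rw [h.cost A hA B hB hAB]
    refine (jumpCost_le hx hyB hxy).trans (ENNReal.ofReal_le_ofReal ?_)
    rw [hye]
    exact sub_le_sub_right (le_max_right _ _) _
  · refine le_iInf₂ fun B hB => ?_
    have hAB : A ≠ B := fun e => hB.2 e.symm
    rw [h.cost A hA B hB.1 hAB]
    refine le_jumpCost fun x hx y hy hxy => ?_
    have hy' : y ∈ extBoundary q A :=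
      ⟨fun hyA => hAB (h.eq_of_mem A hA B hB.1 y hyA hy), x, hx, hxy⟩
    have := sInf_image_le (H := H) hy'
    rcases le_total (sInf (H '' A)) (sInf (H '' extBoundary q A)) with hle | hle
    · rw [exitLevel, max_eq_right hle]
      exact ENNReal.ofReal_le_ofReal (by linarith)
    · rw [exitLevel, max_eq_left hle]
      simp

omit [DecidableEq S] in
theorem vsAux_eq (h : IsCycleLevel H q E V) (hirr : ∀ x y : S, JoinedIn q Set.univ x y)
    (hA : A ∈ E) (hB : B ∈ E) (hAB : A ≠ B) :
    VsAux E V A B = jumpCost H q (exitLevel H q A) A B := by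
  rw [VsAux, h.cost A hA B hB hAB, h.heAux_eq hA (h.exists_mem_extBoundary hirr hA hB hAB),
    jumpCost_tsub sInf_image_le_exitLevel]

omit [DecidableEq S] in
theorem le_exitLevel (h : IsCycleLevel H q E V) (hA : A ∈ E)
    (hbd : (extBoundary q A).Nonempty) (hx : x ∈ A) : H x ≤ exitLevel H q A := by
  rcases A.eq_singleton_or_nontrivial hx with rfl | hnt
  · refine le_trans ?_ (le_max_left _ _)
    simp
  · obtain ⟨y, hy, hye⟩ := exists_eq_sInf_image (H := H) hbd
    exact ((h.lt_boundary A hA hnt x hx y hy).le.trans hye.le).trans (le_max_right _ _)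

omit [DecidableEq S] in
theorem exitLevel_le_of_zeroStep (h : IsCycleLevel H q E V) (hsym : ∀ x y : S, q x y = q y x)
    (hirr : ∀ x y : S, JoinedIn q Set.univ x y) (hs : ZeroStep E V A B) :
    exitLevel H q B ≤ exitLevel H q A := by
  obtain ⟨hA, hB, h0⟩ := hs
  by_cases hAB : A = B
  · rw [hAB]
  rw [h.vsAux_eq hirr hA hB hAB, jumpCost_eq_zero_iff] at h0
  obtain ⟨x, hx, y, hy, hxy, hle⟩ := h0
  have hxB : x ∈ extBoundary q B :=
    ⟨fun hxB => hAB (h.eq_of_mem A hA B hB x hx hxB), y, hy, hsym x y ▸ hxy⟩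
  exact max_le ((sInf_image_le hy).trans hle) ((sInf_image_le hxB).trans
    (h.le_exitLevel hA (h.exists_mem_extBoundary hirr hA hB hAB) hx))

omit [DecidableEq S] in
theorem exitLevel_le_of_arrowAux (h : IsCycleLevel H q E V)
    (hsym : ∀ x y : S, q x y = q y x) (hirr : ∀ x y : S, JoinedIn q Set.univ x y)
    (hA : A ∈ E) (hAB : arrowAux E V A B) : exitLevel H q B ≤ exitLevel H q A := by
  rw [arrowAux_iff hA] at hAB
  induction hAB with
  | refl => exact le_rfl
  | tail _ hs ih => exact (h.exitLevel_le_of_zeroStep hsym hirr hs).trans ih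

omit [Fintype S] [DecidableEq S] in
theorem arrowAux_of_mem_arrowClass (h : IsCycleLevel H q E V) (hB : B ∈ E) (hx : x ∈ B)
    (hxA : x ∈ arrowClass E V A) : arrowAux E V A B ∧ arrowAux E V B A := by
  obtain ⟨C, ⟨hC, h1, h2⟩, hxC⟩ := hxA
  obtain rfl := h.eq_of_mem B hB C hC x hx hxC
  exact ⟨h1, h2⟩

omit [Fintype S] [DecidableEq S] in
theorem subset_arrowClass_of_mem (h : IsCycleLevel H q E V) (hB : B ∈ E) (hx : x ∈ B)
    (hxA : x ∈ arrowClass E V A) : B ⊆ arrowClass E V A :=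
  Set.subset_sUnion_of_mem ⟨hB, h.arrowAux_of_mem_arrowClass hB hx hxA⟩

omit [Fintype S] [DecidableEq S] in
theorem arrowClass_eq_of_subset (h : IsCycleLevel H q E V) (hA : A ∈ E) (hB : B ∈ E)
    (hBA : B ⊆ arrowClass E V A) : arrowClass E V A = arrowClass E V B := by
  obtain ⟨x, hx⟩ := h.nonempty B hB
  obtain ⟨h1, h2⟩ := h.arrowAux_of_mem_arrowClass hB hx (hBA hx)
  exact arrowClass_congr hA hB h1 h2

omit [Fintype S] [DecidableEq S] in
theorem mem_EnextAux (h : IsCycleLevel H q E V) :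
    X ∈ EnextAux E V ↔ ∃ A, A ∈ E ∧ X = arrowClass E V A ∧ arrowClass E V A ∈ DstarAux E V ∨
      A ∈ E ∧ X = A ∧ arrowClass E V A ∉ DstarAux E V := by
  constructor
  · rintro (hX | ⟨hX, D, ⟨⟨A, hA, rfl⟩, hD⟩, hXD⟩)
    · obtain ⟨A, hA, rfl⟩ := hX.1
      exact ⟨A, .inl ⟨hA, rfl, hX⟩⟩
    · exact ⟨X, .inr ⟨hX, rfl, h.arrowClass_eq_of_subset hA hX hXD ▸ hD⟩⟩
  · rintro ⟨A, ⟨hA, rfl, hD⟩ | ⟨hA, rfl, hD⟩⟩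
    · exact .inl hD
    · exact .inr ⟨hA, _, ⟨⟨X, hA, rfl⟩, hD⟩, subset_arrowClass hA⟩

omit [DecidableEq S] in
/-- Every element of the next level is either an old element or a minimal class with at least two
elements; in the latter case all members of the class share the same exit level, which separates
the energies inside from those on the boundary. -/
theorem EnextAux_cases (h : IsCycleLevel H q E V) (hsym : ∀ x y : S, q x y = q y x)
    (hirr : ∀ x y : S, JoinedIn q Set.univ x y) (hX : X ∈ EnextAux E V) :
    X ∈ E ∨ ∃ L : ℝ, (∀ B ∈ E, B ⊆ X → exitLevel H q B = L) ∧ (∀ x ∈ X, H x ≤ L) ∧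
      ∀ y ∈ extBoundary q X, L < H y := by
  obtain ⟨A, ⟨hA, rfl, hD⟩ | ⟨hA, rfl, -⟩⟩ := h.mem_EnextAux.1 hX
  swap
  · exact .inl hA
  by_cases hone : ∀ x ∈ arrowClass E V A, x ∈ A
  · left
    rwa [(subset_arrowClass hA).antisymm hone |>.symm]
  right
  push Not at hone
  obtain ⟨z, hz, hzA⟩ := hone
  have hother : ∀ B ∈ E, ∃ C ∈ E, B ≠ C := by
    intro B hB
    obtain ⟨C, hC, hzC⟩ := h.cover z
    by_cases hBA : B = A
    · exact ⟨C, hC, by rintro rfl; exact hzA (hBA ▸ hzC)⟩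
    · exact ⟨A, hA, hBA⟩
  have hlevel : ∀ B ∈ E, ∀ x ∈ B, x ∈ arrowClass E V A → exitLevel H q B = exitLevel H q A := by
    intro B hB x hx hxA
    obtain ⟨h1, h2⟩ := h.arrowAux_of_mem_arrowClass hB hx hxA
    exact le_antisymm (h.exitLevel_le_of_arrowAux hsym hirr hA h1)
      (h.exitLevel_le_of_arrowAux hsym hirr hB h2)
  refine ⟨exitLevel H q A, fun B hB hBA => ?_, fun x hx => ?_, fun y hy => ?_⟩
  · obtain ⟨x, hx⟩ := h.nonempty B hB
    exact hlevel B hB x hx (hBA hx)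
  · obtain ⟨B, hB, hxB⟩ := h.cover x
    obtain ⟨C, hC, hBC⟩ := hother B hB
    rw [← hlevel B hB x hxB hx]
    exact h.le_exitLevel hB (h.exists_mem_extBoundary hirr hB hC hBC) hxB
  · by_contra! hle
    obtain ⟨hyX, x, hx, hxy⟩ := hy
    obtain ⟨B, hB, hxB⟩ := h.cover x
    obtain ⟨C, hC, hyC⟩ := h.cover y
    have hBA := h.subset_arrowClass_of_mem hB hxB hx
    have hBC : B ≠ C := by rintro rfl; exact hyX (hBA hyC)
    have hstep : ZeroStep E V B C := by
      refine ⟨hB, hC, ?_⟩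
      rw [h.vsAux_eq hirr hB hC hBC, jumpCost_eq_zero_iff]
      exact ⟨x, hxB, y, hyC, hxy, hle.trans (hlevel B hB x hxB hx).ge⟩
    have hBC' : arrowAux E V B C := (arrowAux_iff hB).2 (.single hstep)
    have heq := hD.2 (arrowClass E V C) ⟨C, hC, rfl⟩
      ⟨B, hB, C, hC, hBA, subset_arrowClass hC, hBC'⟩
    exact hyX (heq ▸ subset_arrowClass hC hyC)

omit [DecidableEq S] in
theorem vnextAux_eq (h : IsCycleLevel H q E V) (hirr : ∀ x y : S, JoinedIn q Set.univ x y)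
    {L : ℝ} (hXne : X.Nonempty) (hYne : Y.Nonempty) (hXY : Disjoint X Y)
    (hX : ∀ B ∈ E, ∀ x ∈ B, x ∈ X → B ⊆ X) (hY : ∀ B ∈ E, ∀ x ∈ B, x ∈ Y → B ⊆ Y)
    (hL : ∀ B ∈ E, B ⊆ X → exitLevel H q B = L)
    (hbd : L ≤ sInf (H '' X) ∨ ∀ y ∈ extBoundary q X, L ≤ H y) :
    VnextAux E V X Y = jumpCost H q (sInf (H '' X)) X Y := by
  obtain ⟨C, hC, hCY⟩ : ∃ C ∈ E, C ⊆ Y := by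
    obtain ⟨y, hy⟩ := hYne
    obtain ⟨C, hC, hyC⟩ := h.cover y
    exact ⟨C, hC, hY C hC y hyC hy⟩
  have hne : ∀ B ∈ E, B ⊆ X → ∀ B' ∈ E, B' ⊆ Y → B ≠ B' := by
    rintro B hB hBX _ - hBY rfl
    obtain ⟨x, hx⟩ := h.nonempty B hB
    exact Set.disjoint_left.1 hXY (hBX hx) (hBY hx)
  obtain ⟨x₀, hx₀, hx₀e⟩ := exists_eq_sInf_image (H := H) hXne
  obtain ⟨B₀, hB₀, hx₀B⟩ := h.cover x₀
  have hB₀X := hX B₀ hB₀ x₀ hx₀B hx₀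
  have hmin : sInf (H '' B₀) = sInf (H '' X) :=
    le_antisymm (hx₀e ▸ sInf_image_le hx₀B) (sInf_image_le_of_subset ⟨x₀, hx₀B⟩ hB₀X)
  have hLX : sInf (H '' X) ≤ L := by
    rw [← hmin, ← hL B₀ hB₀ hB₀X]
    exact sInf_image_le_exitLevel
  have hHe : ∀ B ∈ E, B ⊆ X → HeAux E V B = ENNReal.ofReal (L - sInf (H '' B)) := by
    intro B hB hBX
    rw [h.heAux_eq hB (h.exists_mem_extBoundary hirr hB hC (hne B hB hBX C hC hCY)), hL B hB hBX]
  have hHm : HmAux E V X = ENNReal.ofReal (L - sInf (H '' X)) := by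
    apply le_antisymm
    · refine iSup₂_le fun B hB => ?_
      rw [hHe B hB.1 hB.2]
      exact ENNReal.ofReal_le_ofReal
        (sub_le_sub_left (sInf_image_le_of_subset (h.nonempty B hB.1) hB.2) _)
    · rw [← hmin, ← hHe B₀ hB₀ hB₀X]
      exact le_iSup₂_of_le B₀ ⟨hB₀, hB₀X⟩ le_rfl
  have hVs : (⨅ B ∈ {B | B ∈ E ∧ B ⊆ X}, ⨅ B' ∈ {B' | B' ∈ E ∧ B' ⊆ Y}, VsAux E V B B') =
      jumpCost H q L X Y := by
    apply le_antisymm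
    · refine le_jumpCost fun x hx y hy hxy => ?_
      obtain ⟨B, hB, hxB⟩ := h.cover x
      obtain ⟨B', hB', hyB⟩ := h.cover y
      have hBX := hX B hB x hxB hx
      have hBY := hY B' hB' y hyB hy
      refine (iInf₂_le_of_le B ⟨hB, hBX⟩ (iInf₂_le B' ⟨hB', hBY⟩)).trans ?_
      rw [h.vsAux_eq hirr hB hB' (hne B hB hBX B' hB' hBY), hL B hB hBX]
      exact jumpCost_le hxB hyB hxy
    · refine le_iInf₂ fun B hB => le_iInf₂ fun B' hB' => ?_
      rw [h.vsAux_eq hirr hB.1 hB'.1 (hne B hB.1 hB.2 B' hB'.1 hB'.2), hL B hB.1 hB.2]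
      exact le_jumpCost fun x hx y hy hxy => jumpCost_le (hB.2 hx) (hB'.2 hy) hxy
  rw [VnextAux, hHm, hVs, jumpCost, jumpCost, ENNReal.add_iInf]
  refine iInf_congr fun p => ?_
  rcases hbd with hle | hle
  · rw [le_antisymm hle hLX]
    simp
  · have hp := hle p.1.2 ⟨Set.disjoint_right.1 hXY p.2.2.1, p.1.1, p.2.1, p.2.2.2⟩
    rw [← ENNReal.ofReal_add (by linarith) (by linarith)]
    congr 1
    ring

omit [DecidableEq S] in
/-- The properties of a level are inherited by the next one. -/
theorem next (h : IsCycleLevel H q E V) (hsym : ∀ x y : S, q x y = q y x)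
    (hirr : ∀ x y : S, JoinedIn q Set.univ x y) :
    IsCycleLevel H q (EnextAux E V) (VnextAux E V) := by
  have hsat : ∀ X ∈ EnextAux E V, ∀ B ∈ E, ∀ x ∈ B, x ∈ X → B ⊆ X := by
    intro X hX B hB x hx hxX
    obtain ⟨A, ⟨hA, rfl, -⟩ | ⟨hA, rfl, -⟩⟩ := h.mem_EnextAux.1 hX
    · exact h.subset_arrowClass_of_mem hB hx hxX
    · exact (h.eq_of_mem B hB X hA x hx hxX).subset
  have hnonempty : ∀ X ∈ EnextAux E V, X.Nonempty := by
    intro X hX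
    obtain ⟨A, ⟨hA, rfl, -⟩ | ⟨hA, rfl, -⟩⟩ := h.mem_EnextAux.1 hX
    · exact (h.nonempty A hA).mono (subset_arrowClass hA)
    · exact h.nonempty X hA
  have hchar : ∀ X ∈ EnextAux E V, ∀ A ∈ E, ∀ x ∈ A, x ∈ X →
      X = arrowClass E V A ∧ arrowClass E V A ∈ DstarAux E V ∨
      X = A ∧ arrowClass E V A ∉ DstarAux E V := by
    intro X hX A hA x hx hxX
    obtain ⟨B, ⟨hB, rfl, hD⟩ | ⟨hB, rfl, hD⟩⟩ := h.mem_EnextAux.1 hX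
    · have := h.arrowClass_eq_of_subset hB hA (h.subset_arrowClass_of_mem hA hx hxX)
      exact .inl ⟨this, this ▸ hD⟩
    · obtain rfl := h.eq_of_mem X hB A hA x hxX hx
      exact .inr ⟨rfl, hD⟩
  have heq : ∀ X ∈ EnextAux E V, ∀ Y ∈ EnextAux E V, ∀ x, x ∈ X → x ∈ Y → X = Y := by
    intro X hX Y hY x hxX hxY
    obtain ⟨A, hA, hxA⟩ := h.cover x
    rcases hchar X hX A hA x hxA hxX with ⟨h1, h1'⟩ | ⟨h1, h1'⟩ <;>
      rcases hchar Y hY A hA x hxA hxY with ⟨h2, h2'⟩ | ⟨h2, h2'⟩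
    · rw [h1, h2]
    · exact absurd h1' h2'
    · exact absurd h2' h1'
    · rw [h1, h2]
  refine ⟨hnonempty, heq, fun x => ?_, fun X hX hnt x hx y hy => ?_, fun X hX Y hY hne => ?_⟩
  · obtain ⟨A, hA, hxA⟩ := h.cover x
    by_cases hD : arrowClass E V A ∈ DstarAux E V
    · exact ⟨_, .inl hD, subset_arrowClass hA hxA⟩
    · exact ⟨A, h.mem_EnextAux.2 ⟨A, .inr ⟨hA, rfl, hD⟩⟩, hxA⟩
  · rcases h.EnextAux_cases hsym hirr hX with hXE | ⟨L, -, h1, h2⟩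
    · exact h.lt_boundary X hXE hnt x hx y hy
    · exact (h1 x hx).trans_lt (h2 y hy)
  · have hdisj : Disjoint X Y :=
      Set.disjoint_left.2 fun x hxX hxY => hne (heq X hX Y hY x hxX hxY)
    rcases h.EnextAux_cases hsym hirr hX with hXE | ⟨L, hL, -, h2⟩
    · refine h.vnextAux_eq hirr (L := exitLevel H q X) (hnonempty X hX) (hnonempty Y hY) hdisj
        (hsat X hX) (hsat Y hY) (fun B hB hBX => ?_) ?_
      · obtain ⟨x, hx⟩ := h.nonempty B hB
        rw [h.eq_of_mem B hB X hXE x hx (hBX hx)]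
      · rcases le_total (sInf (H '' X)) (sInf (H '' extBoundary q X)) with hle | hle
        · right
          intro y hy
          rw [exitLevel, max_eq_right hle]
          exact sInf_image_le hy
        · left
          rw [exitLevel, max_eq_left hle]
    · exact h.vnextAux_eq hirr (hnonempty X hX) (hnonempty Y hY) hdisj (hsat X hX) (hsat Y hY) hL
        (.inr fun y hy => (h2 y hy).le)

end IsCycleLevel

omit [Fintype S] [DecidableEq S] in
theorem isCycleLevel_zero (H : S → ℝ) (q : S → S → ℝ) :
    IsCycleLevel H q {A | ∃ i, A = {i}} (V0 H q) where
  nonempty := by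
    rintro _ ⟨i, rfl⟩
    exact Set.singleton_nonempty i
  eq_of_mem := by
    rintro _ ⟨i, rfl⟩ _ ⟨j, rfl⟩ x rfl hx
    rw [Set.mem_singleton_iff.1 hx]
  cover x := ⟨{x}, ⟨x, rfl⟩, rfl⟩
  lt_boundary := by
    rintro _ ⟨i, rfl⟩ hnt
    exact absurd hnt Set.not_nontrivial_singleton
  cost := by
    rintro _ ⟨i, rfl⟩ _ ⟨j, rfl⟩ -
    have hmin : sInf (H '' {i}) = H i := by simp
    rw [hmin]
    apply le_antisymm
    · refine le_jumpCost fun x hx y hy hxy => ?_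
      obtain rfl := Set.mem_singleton_iff.1 hx
      obtain rfl := Set.mem_singleton_iff.1 hy
      exact iInf₂_le_of_le x hx (iInf₂_le_of_le y hy (iInf_le _ ⟨rfl, rfl, hxy⟩))
    · refine le_iInf₂ fun x hx => le_iInf₂ fun y hy => le_iInf fun hxy => ?_
      obtain rfl := Set.mem_singleton_iff.1 hx
      exact jumpCost_le hx hy hxy.2.2

omit [DecidableEq S] in
/-- Every level of the graph-cycle construction satisfies `IsCycleLevel`. -/
theorem isCycleLevel_cyc {H : S → ℝ} {q : S → S → ℝ} (hsym : ∀ x y : S, q x y = q y x)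
    (hirr : ∀ x y : S, JoinedIn q Set.univ x y) (n : ℕ) :
    IsCycleLevel H q (Ecyc H q n) (Vcyc H q n) := by
  induction n with
  | zero => exact isCycleLevel_zero H q
  | succ n ih => exact ih.next hsym hirr

/-- If `A ∈ E^n` with `|A| > 1` and the singleton `{a} ∈ E^n` is connected to `A`
(`a ∈ ∂A`), then `V^n(A,{a}) = H a - min_A H` and `V^n({a},A) = 0`. -/
theorem Vcyc_singleton (H : S → ℝ) (q : S → S → ℝ)
    (hq : ∀ x y : S, 0 ≤ q x y ∧ q x y ≤ 1)
    (hsum : ∀ x : S, ∑ y ∈ Finset.univ.erase x, q x y ≤ 1)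
    (hsym : ∀ x y : S, q x y = q y x)
    (hirr : ∀ x y : S, JoinedIn q Set.univ x y)
    (n : ℕ) (A : Set S) (hA : A ∈ Ecyc H q n) (hcard : 1 < A.ncard)
    (a : S) (ha : ({a} : Set S) ∈ Ecyc H q n) (hab : a ∈ extBoundary q A) :
    Vcyc H q n A {a} = ENNReal.ofReal (H a - sInf (H '' A)) ∧
      Vcyc H q n {a} A = 0 := by
  have h := isCycleLevel_cyc (H := H) hsym hirr n
  have hnt : A.Nontrivial := Set.one_lt_ncard_iff_nontrivial.1 hcard
  obtain ⟨haA, x, hx, hxa⟩ := id hab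
  have hne : A ≠ {a} := by rintro rfl; exact haA rfl
  constructor
  · rw [h.cost A hA {a} ha hne]
    apply le_antisymm
    · exact jumpCost_le hx rfl hxa
    · refine le_jumpCost fun y _ z hz _ => ?_
      rw [Set.mem_singleton_iff.1 hz]
  · rw [h.cost {a} ha A hA hne.symm, jumpCost_eq_zero_iff]
    exact ⟨a, rfl, x, hx, hsym x a ▸ hxa, by simpa using (h.lt_boundary A hA hnt x hx a hab).le⟩

end MetropolisCycles
end
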